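/- arXiv:1911.08449 — 2 statements merged into one kernel-verified Lean document; each statement's English description precedes it below -/
import Mathlib

section
/- Consider N users and M packets. Let ε_1, …, ε_N be independent random variables uniformly distributed on [0,1]. Conditionally on ε_i, let the receptions r_{i,1}, …, r_{i,M} of the M data packets and the reception s_i of the coded packet by user i be conditionally independent Bernoulli(1−ε_i) random variables, with all randomness independent across different users. Let C be a subset of {1, …, M} of size d (1 ≤ d ≤ M) chosen uniformly at random, independently of everything else. Let y'_{d,i} be the indicator that s_i = 1 and exactly one index j ∈ C has r_{i,j} = 0, and let Y'_d = Σ_{i=1}^N y'_{d,i}. For each i let H_i be the event that Σ_{j=1}^M r_{i,j} = h_i, where 0 ≤ h_i ≤ M. Then E[Y'_d | H_1 ∩ H_2 ∩ … ∩ H_N] = Σ_{i=1}^N ( C(h_i, d−1)·(M−h_i)/C(M, d) ) · ( (h_i+1)/(M+2) ), where C(n,k) denotes the binomial coefficient. -/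
open MeasureTheory
open scoped ENNReal

lemma aux_integral_fin {Ω α : Type*} [MeasurableSpace Ω] [Fintype α] (μ : Measure Ω)
    [IsProbabilityMeasure μ] (X : Ω → α) (hX : ∀ a, MeasurableSet (X ⁻¹' {a})) (F : α → ℝ) :
    ∫ ω, F (X ω) ∂μ = ∑ a, μ.real (X ⁻¹' {a}) * F a := by
  classical
  have h1 : ∀ ω, F (X ω) = ∑ a, (X ⁻¹' {a}).indicator (fun _ => F a) ω := by
    intro ω
    rw [Finset.sum_eq_single (X ω)]
    · simp
    · intro b _ hb
      simp [Set.indicator, hb.symm]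
    · simp
  simp_rw [h1]
  rw [integral_finset_sum]
  · refine Finset.sum_congr rfl fun a _ => ?_
    rw [integral_indicator_const _ (hX a)]
    simp
  · intro a _
    exact (integrable_const _).indicator (hX a)

lemma aux_prod_sum {N : ℕ} {β : Type*} [Fintype β] (W : Fin N → β → ℝ) (g : Fin N → β → ℝ)
    (hQ : ∀ i, ∑ x, W i x ≠ 0) :
    ∑ f : Fin N → β, (∏ k, W k (f k)) * ∑ i, g i (f i)
      = (∏ k, ∑ x, W k x) * ∑ i, (∑ x, W i x * g i x) / ∑ x, W i x := by
  classical
  simp_rw [Finset.mul_sum]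
  rw [Finset.sum_comm]
  refine Finset.sum_congr rfl fun i _ => ?_
  have h1 : ∀ f : Fin N → β, (∏ k, W k (f k)) * g i (f i)
      = ∏ k, (W k (f k) * if k = i then g i (f k) else 1) := by
    intro f
    rw [Finset.prod_mul_distrib]
    simp
  simp_rw [h1]
  have h2 := (Fintype.prod_sum (fun k (x : β) => (W k x * if k = i then g i x else 1))).symm
  rw [h2]
  have h3 : ∀ k, (∑ x, W k x * if k = i then g i x else 1)
      = (∑ x, W k x) * if k = i then (∑ x, W i x * g i x) / ∑ x, W i x else 1 := by
    intro k
    by_cases hk : k = i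
    · subst hk
      simp only [if_true]
      rw [mul_div_cancel₀ _ (hQ k)]
    · simp [hk]
  simp_rw [h3]
  rw [Finset.prod_mul_distrib]
  simp

/-- number of received packets -/
def auxCnt {M : ℕ} (b : Fin M → Bool) : ℕ := ∑ j, if b j then 1 else 0

noncomputable def auxW {M : ℕ} (x : (Fin M → Bool) × Bool) : ℝ :=
  ∫ u in (0:ℝ)..1, ((∏ j, if x.1 j then 1 - u else u) * (if x.2 then 1 - u else u))

lemma auxCnt_eq {M : ℕ} (b : Fin M → Bool) :
    auxCnt b = (Finset.univ.filter fun j => b j = true).card := by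
  simp [auxCnt]

lemma auxCnt_add {M : ℕ} (b : Fin M → Bool) :
    auxCnt b + (Finset.univ.filter fun j => b j = false).card = M := by
  rw [auxCnt_eq]
  have := Finset.card_filter_add_card_filter_not (s := (Finset.univ : Finset (Fin M)))
    (fun j => b j = true)
  simpa using this

lemma auxCnt_le {M : ℕ} (b : Fin M → Bool) : auxCnt b ≤ M := by
  have := auxCnt_add b
  omega

lemma aux_prod_pow {M : ℕ} (b : Fin M → Bool) (u : ℝ) :
    (∏ j, if b j then 1 - u else u) = u ^ (M - auxCnt b) * (1 - u) ^ (auxCnt b) := by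
  have h1 := auxCnt_add b
  have h2 : M - auxCnt b = (Finset.univ.filter fun j => b j = false).card := by omega
  rw [h2, auxCnt_eq, Finset.prod_ite]
  simp [mul_comm]

lemma aux_beta (a b : ℕ) :
    ((a:ℝ) + 1) * (∫ u in (0:ℝ)..1, u ^ a * (1 - u) ^ (b+1))
      = ((b:ℝ)+1) * ∫ u in (0:ℝ)..1, u ^ (a+1) * (1 - u) ^ b := by
  have hd : ∀ u ∈ Set.uIcc (0:ℝ) 1, HasDerivAt (fun u : ℝ => u ^ (a+1) * (1-u)^(b+1))
      (((a:ℝ) + 1) * (u ^ a * (1 - u) ^ (b+1)) - ((b:ℝ)+1) * (u ^ (a+1) * (1 - u) ^ b)) u := by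
    intro u _
    have h1 := (hasDerivAt_id' u).fun_pow (a+1)
    have h2 := ((hasDerivAt_id' u).const_sub 1).fun_pow (b+1)
    refine (h1.fun_mul h2).congr_deriv ?_
    push_cast
    ring
  have := intervalIntegral.integral_eq_sub_of_hasDerivAt hd
    (by apply Continuous.intervalIntegrable; fun_prop)
  rw [intervalIntegral.integral_sub (by apply Continuous.intervalIntegrable; fun_prop)
    (by apply Continuous.intervalIntegrable; fun_prop),
    intervalIntegral.integral_const_mul, intervalIntegral.integral_const_mul] at this
  simp at this
  linarith

lemma aux_beta_pos (a b : ℕ) : 0 < ∫ u in (0:ℝ)..1, u ^ a * (1 - u) ^ b := by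
  apply intervalIntegral.intervalIntegral_pos_of_pos_on
  · apply Continuous.intervalIntegrable; fun_prop
  · intro x hx
    have : 0 < 1 - x := by linarith [hx.2]
    have := hx.1
    positivity
  · norm_num

lemma auxW_true {M : ℕ} (b : Fin M → Bool) :
    auxW (b, true) = ∫ u in (0:ℝ)..1, u ^ (M - auxCnt b) * (1 - u) ^ (auxCnt b + 1) := by
  simp only [auxW, aux_prod_pow]
  simp [pow_succ, mul_assoc]

lemma auxW_false {M : ℕ} (b : Fin M → Bool) :
    auxW (b, false) = ∫ u in (0:ℝ)..1, u ^ (M - auxCnt b + 1) * (1 - u) ^ (auxCnt b) := by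
  simp only [auxW, aux_prod_pow]
  simp [pow_succ, mul_assoc, mul_comm]

lemma auxW_nonneg {M : ℕ} (x : (Fin M → Bool) × Bool) : 0 ≤ auxW x := by
  rcases x with ⟨b, _ | _⟩
  · rw [auxW_false]; exact (aux_beta_pos _ _).le
  · rw [auxW_true]; exact (aux_beta_pos _ _).le

/-- integral depending on count only -/
noncomputable def auxV (M h : ℕ) : ℝ :=
  (∫ u in (0:ℝ)..1, u ^ (M - h) * (1 - u) ^ (h + 1)) +
  ∫ u in (0:ℝ)..1, u ^ (M - h + 1) * (1 - u) ^ h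

lemma auxV_pos (M h : ℕ) : 0 < auxV M h := add_pos (aux_beta_pos _ _) (aux_beta_pos _ _)

lemma auxV_eq (M h : ℕ) (hh : h ≤ M) :
    (∫ u in (0:ℝ)..1, u ^ (M - h) * (1 - u) ^ (h + 1)) = ((h:ℝ)+1)/((M:ℝ)+2) * auxV M h := by
  have := aux_beta (M - h) h
  push_cast [hh] at this
  have h2 : (0:ℝ) < (M:ℝ) + 2 := by positivity
  unfold auxV
  field_simp
  linarith

lemma auxW_sum {M : ℕ} : ∑ x : (Fin M → Bool) × Bool, auxW x = 1 := by
  unfold auxW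
  rw [← intervalIntegral.integral_finset_sum]
  · have : ∀ u : ℝ, ∑ x : (Fin M → Bool) × Bool,
        ((∏ j, if x.1 j then 1 - u else u) * (if x.2 then 1 - u else u)) = 1 := by
      intro u
      rw [Fintype.sum_prod_type]
      have h3 : ∀ b : Fin M → Bool, ∑ t : Bool,
          ((∏ j, if b j then 1 - u else u) * (if t then 1 - u else u))
          = ∏ j, if b j then 1 - u else u := by
        intro b
        rw [← Finset.mul_sum]
        simp
      have h2 := (Fintype.prod_sum (fun (_ : Fin M) (x : Bool) => if x then 1 - u else u)).symm
      rw [Finset.sum_congr rfl fun b _ => h3 b, h2]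
      simp
    simp_rw [this]
    simp
  · intro x _
    apply Continuous.intervalIntegrable
    refine Continuous.mul (continuous_finset_prod _ fun j _ => ?_) ?_
    · split_ifs <;> fun_prop
    · split_ifs <;> fun_prop

lemma auxW_lintegral {M : ℕ} (b : Fin M → Bool) (t : Bool) :
    (∫⁻ x in Set.univ, ENNReal.ofReal
              ((∏ j, if b j then 1 - x else x) * (if t then 1 - x else x))
              ∂(volume.restrict (Set.Icc (0 : ℝ) 1))) = ENNReal.ofReal (auxW (b, t)) := by
  have hc : Continuous fun x : ℝ => ((∏ j, if b j then 1 - x else x) * (if t then 1 - x else x)) := by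
    refine Continuous.mul (continuous_finset_prod _ fun j _ => ?_) ?_
    · split_ifs <;> fun_prop
    · split_ifs <;> fun_prop
  rw [Measure.restrict_univ, auxW, intervalIntegral.integral_of_le zero_le_one,
    ← integral_Icc_eq_integral_Ioc]
  rw [ofReal_integral_eq_lintegral_ofReal]
  · exact hc.integrableOn_Icc
  · filter_upwards [ae_restrict_mem measurableSet_Icc] with x hx
    have h1 : 0 ≤ x := hx.1
    have h2 : 0 ≤ 1 - x := by linarith [hx.2]
    refine mul_nonneg (Finset.prod_nonneg fun j _ => ?_) ?_ <;> split_ifs <;> assumption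

/-- counting -/
lemma aux_count {M : ℕ} (d : ℕ) (hd : 1 ≤ d) (Z : Finset (Fin M)) :
    ((Finset.powersetCard d (Finset.univ : Finset (Fin M))).filter
      fun c => (c ∩ Z).card = 1).card = Z.card * (M - Z.card).choose (d - 1) := by
  classical
  have hZ : (Zᶜ).card = M - Z.card := by simp [Finset.card_compl]
  rw [← hZ, ← Finset.card_powersetCard, ← Finset.card_product]
  symm
  refine Finset.card_bij (fun p _ => insert p.1 p.2) ?_ ?_ ?_
  · rintro ⟨z, e⟩ hp
    simp only [Finset.mem_product, Finset.mem_powersetCard] at hp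
    obtain ⟨hz, he, hc⟩ := hp
    have hdis : e ∩ Z = ∅ := by
      rw [← Finset.disjoint_iff_inter_eq_empty]
      exact (Finset.subset_compl_iff_disjoint_right.mp he)
    have hze : z ∉ e := fun h => (Finset.mem_compl.mp (he h)) hz
    simp only [Finset.mem_filter, Finset.mem_powersetCard, Finset.subset_univ, true_and]
    refine ⟨?_, ?_⟩
    · rw [Finset.card_insert_of_notMem hze, hc]; omega
    · rw [Finset.insert_inter_of_mem hz, hdis]; simp
  · rintro ⟨z, e⟩ hp ⟨z', e'⟩ hp' heq
    simp only [Finset.mem_product, Finset.mem_powersetCard] at hp hp' heq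
    have he : ∀ y ∈ e, y ∉ Z := fun y hy => Finset.mem_compl.mp (hp.2.1 hy)
    have he' : ∀ y ∈ e', y ∉ Z := fun y hy => Finset.mem_compl.mp (hp'.2.1 hy)
    have hzz : z = z' := by
      have : z ∈ insert z' e' := heq ▸ Finset.mem_insert_self z e
      rcases Finset.mem_insert.mp this with h | h
      · exact h
      · exact absurd hp.1 (he' _ h)
    subst hzz
    have h1 : z ∉ e := fun h => he _ h hp.1
    have h2 : z ∉ e' := fun h => he' _ h hp'.1
    have : e = e' := by
      rw [← Finset.erase_insert h1, heq, Finset.erase_insert h2]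
    rw [this]
  · intro c hc
    simp only [Finset.mem_filter, Finset.mem_powersetCard, Finset.subset_univ, true_and] at hc
    obtain ⟨hc, h1⟩ := hc
    obtain ⟨z, hz⟩ := Finset.card_eq_one.mp h1
    have hzc : z ∈ c ∩ Z := by rw [hz]; simp
    rw [Finset.mem_inter] at hzc
    refine ⟨(z, c.erase z), ?_, ?_⟩
    · simp only [Finset.mem_product, Finset.mem_powersetCard]
      refine ⟨hzc.2, ?_, ?_⟩
      · intro y hy
        rw [Finset.mem_compl]
        intro hyZ
        have : y ∈ c ∩ Z := Finset.mem_inter.mpr ⟨Finset.mem_of_mem_erase hy, hyZ⟩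
        rw [hz, Finset.mem_singleton] at this
        exact (Finset.ne_of_mem_erase hy) this
      · rw [Finset.card_erase_of_mem hzc.1, hc]
    · exact Finset.insert_erase hzc.1

/-- restricted weight -/
noncomputable def auxW' {M : ℕ} (h : ℕ) (x : (Fin M → Bool) × Bool) : ℝ :=
  if auxCnt x.1 = h then auxW x else 0

/-- recovery indicator -/
def auxG {M : ℕ} (c : Finset (Fin M)) (x : (Fin M → Bool) × Bool) : ℝ :=
  if x.2 = true ∧ (c.filter fun j => x.1 j = false).card = 1 then 1 else 0

lemma auxQ {M : ℕ} (h : ℕ) :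
    ∑ x : (Fin M → Bool) × Bool, auxW' h x
      = ((Finset.univ.filter fun b : Fin M → Bool => auxCnt b = h).card : ℝ) * auxV M h := by
  rw [Fintype.sum_prod_type]
  simp only [Fintype.sum_bool, auxW', auxW_true, auxW_false]
  rw [Finset.card_eq_sum_ones, Nat.cast_sum, Finset.sum_mul, Finset.sum_filter]
  refine Finset.sum_congr rfl fun b _ => ?_
  split_ifs with hb
  · rw [hb]; simp [auxV]
  · simp

lemma aux_card_pos {M : ℕ} (h : ℕ) (hh : h ≤ M) :
    0 < (Finset.univ.filter fun b : Fin M → Bool => auxCnt b = h).card := by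
  classical
  obtain ⟨S, hS⟩ := Finset.exists_subset_card_eq (s := (Finset.univ : Finset (Fin M))) (n := h)
    (by simpa using hh)
  refine Finset.card_pos.mpr ⟨fun j => decide (j ∈ S), ?_⟩
  simp [auxCnt_eq, hS.2]

lemma auxQ_pos {M : ℕ} (h : ℕ) (hh : h ≤ M) :
    0 < ∑ x : (Fin M → Bool) × Bool, auxW' h x := by
  rw [auxQ]
  exact mul_pos (by exact_mod_cast aux_card_pos h hh) (auxV_pos _ _)

lemma auxR {M : ℕ} (d h : ℕ) (hd : 1 ≤ d) (hh : h ≤ M) :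
    ∑ c ∈ Finset.powersetCard d (Finset.univ : Finset (Fin M)),
      (∑ x : (Fin M → Bool) × Bool, auxW' h x * auxG c x) / (∑ x : (Fin M → Bool) × Bool, auxW' h x)
      = (h.choose (d-1) : ℝ) * ((M:ℝ) - h) * (((h:ℝ) + 1) / ((M:ℝ)+2)) := by
  classical
  rw [← Finset.sum_div, div_eq_iff (auxQ_pos h hh).ne', Finset.sum_comm, Fintype.sum_prod_type, auxQ]
  simp only [Fintype.sum_bool]
  rw [Finset.card_eq_sum_ones, Nat.cast_sum, Finset.sum_mul, Finset.mul_sum, Finset.sum_filter]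
  refine Finset.sum_congr rfl fun b _ => ?_
  by_cases hb : auxCnt b = h
  · rw [if_pos hb]
    have h1 := aux_count d hd (Finset.univ.filter fun j => b j = false)
    have h2 := auxCnt_add b
    have h3 : (Finset.univ.filter fun j => b j = false).card = M - h := by omega
    rw [h3, show M - (M - h) = h by omega] at h1
    have h4 : ∀ c : Finset (Fin M), c ∩ (Finset.univ.filter fun j => b j = false)
        = c.filter fun j => b j = false := by
      intro c; ext; simp
    simp only [h4] at h1
    have h5 : ((M - h : ℕ) : ℝ) = (M:ℝ) - h := by push_cast [hh]; ring
    simp only [auxG, auxW', hb, if_true, true_and]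
    rw [← Finset.mul_sum, Finset.sum_boole, h1, auxW_true, hb, auxV_eq M h hh]
    push_cast [h5]
    simp
    ring
  · simp [auxW', hb]

/-- `N` users have i.i.d. erasure rates `ε_i` uniform on `[0,1]`; given
`ε_i`, the receptions `r_{i,1}, …, r_{i,M}` of the `M` data packets and the reception
`s_i` of the coded packet by user `i` are conditionally independent `Bernoulli(1−ε_i)`,
independently across users; the coding set `C` is a uniformly random `d`-subset of the
`M` packets, independent of everything else (this joint law is specified by `hlaw`).
With `Y'_d` the number of users `i` having `s_i = 1` and exactly one `j ∈ C` with
`r_{i,j} = 0`, and `H_i` the event `Σ_j r_{i,j} = h_i`, one has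
`E[Y'_d | H_1 ∩ ⋯ ∩ H_N] = Σ_i (C(h_i,d−1)(M−h_i)/C(M,d))·((h_i+1)/(M+2))`. -/
theorem stmt_3 {Ω : Type*} [MeasurableSpace Ω] (μ : Measure Ω) [IsProbabilityMeasure μ]
    (N M d : ℕ) (hd1 : 1 ≤ d) (hdM : d ≤ M)
    (eps : Fin N → Ω → ℝ) (r : Fin N → Fin M → Ω → Bool) (s : Fin N → Ω → Bool)
    (C : Ω → Finset (Fin M))
    (hmeas_eps : ∀ i, Measurable (eps i)) (hmeas_r : ∀ i j, Measurable (r i j))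
    (hmeas_s : ∀ i, Measurable (s i)) (hmeas_C : ∀ c, MeasurableSet {ω | C ω = c})
    (hlaw : ∀ (A : Fin N → Set ℝ), (∀ i, MeasurableSet (A i)) →
      ∀ (b : Fin N → Fin M → Bool) (t : Fin N → Bool) (c : Finset (Fin M)), c.card = d →
      μ {ω | C ω = c ∧ ∀ i, eps i ω ∈ A i ∧ (∀ j, r i j ω = b i j) ∧ s i ω = t i}
        = ((Nat.choose M d : ℝ≥0∞))⁻¹ *
          ∏ i, ∫⁻ x in A i, ENNReal.ofReal
              ((∏ j, if b i j then 1 - x else x) * (if t i then 1 - x else x))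
              ∂(volume.restrict (Set.Icc (0 : ℝ) 1)))
    (Y : Ω → ℕ)
    (hY : ∀ ω, Y ω = (Finset.univ.filter fun i : Fin N =>
        s i ω = true ∧ ((C ω).filter fun j => r i j ω = false).card = 1).card)
    (h : Fin N → ℕ) (hh : ∀ i, h i ≤ M)
    (H : Set Ω) (hH : H = {ω | ∀ i, (∑ j, if r i j ω then 1 else 0) = h i}) :
    (∫ ω in H, (Y ω : ℝ) ∂μ) / (μ H).toReal
      = ∑ i, ((Nat.choose (h i) (d - 1) : ℝ) * ((M : ℝ) - (h i : ℝ))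
            / (Nat.choose M d : ℝ)) * (((h i : ℝ) + 1) / ((M : ℝ) + 2)) := by
  classical
  let X : Ω → Finset (Fin M) × (Fin N → (Fin M → Bool) × Bool) :=
    fun ω => (C ω, fun i => (fun j => r i j ω, s i ω))
  have hpre : ∀ a, X ⁻¹' {a} = {ω | C ω = a.1} ∩
      ⋂ i, ((⋂ j, (r i j) ⁻¹' {(a.2 i).1 j}) ∩ (s i) ⁻¹' {(a.2 i).2}) := by
    intro a
    ext ω
    simp [X, Prod.ext_iff, funext_iff]
  have hX : ∀ a, MeasurableSet (X ⁻¹' {a}) := by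
    intro a
    rw [hpre]
    refine (hmeas_C _).inter (MeasurableSet.iInter fun i => MeasurableSet.inter
      (MeasurableSet.iInter fun j => ?_) ?_)
    · exact hmeas_r i j (measurableSet_singleton _)
    · exact hmeas_s i (measurableSet_singleton _)
  have hK : (0:ℝ) < Nat.choose M d := by exact_mod_cast Nat.choose_pos hdM
  have hatom : ∀ a, a.1.card = d → μ.real (X ⁻¹' {a}) = (Nat.choose M d : ℝ)⁻¹ * ∏ i, auxW (a.2 i) := by
    intro a ha
    have h1 := hlaw (fun _ => Set.univ) (fun _ => MeasurableSet.univ) (fun i => (a.2 i).1)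
      (fun i => (a.2 i).2) a.1 ha
    simp only [auxW_lintegral] at h1
    have h2 : X ⁻¹' {a} = {ω | C ω = a.1 ∧ ∀ i, eps i ω ∈ Set.univ ∧ (∀ j, r i j ω = (a.2 i).1 j) ∧
        s i ω = (a.2 i).2} := by
      ext ω
      simp [X, Prod.ext_iff, funext_iff]
    rw [Measure.real, h2, h1, ENNReal.toReal_mul, ENNReal.toReal_prod, ENNReal.toReal_inv]
    simp [ENNReal.toReal_ofReal (auxW_nonneg _)]
  have htot : ∑ a, μ.real (X ⁻¹' {a}) = 1 := by
    have := aux_integral_fin μ X hX (fun _ => 1)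
    simpa using this.symm
  have hsumf : ∑ f : Fin N → (Fin M → Bool) × Bool, ∏ i, auxW (f i) = 1 := by
    have := (Fintype.prod_sum (fun (_ : Fin N) (x : (Fin M → Bool) × Bool) => auxW x)).symm
    rw [this]
    simp [auxW_sum]
  have hcard : ∑ c ∈ Finset.powersetCard d (Finset.univ : Finset (Fin M)),
      ∑ f : Fin N → (Fin M → Bool) × Bool, μ.real (X ⁻¹' {(c, f)}) = 1 := by
    have : ∀ c ∈ Finset.powersetCard d (Finset.univ : Finset (Fin M)),
      ∑ f : Fin N → (Fin M → Bool) × Bool, μ.real (X ⁻¹' {(c, f)}) = (Nat.choose M d : ℝ)⁻¹ := by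
      intro c hc
      rw [Finset.sum_congr rfl fun f _ => hatom (c, f) (Finset.mem_powersetCard.mp hc).2]
      rw [← Finset.mul_sum, hsumf, mul_one]
    rw [Finset.sum_congr rfl this]
    simp [hK.ne']
  have hzero : ∀ c, c ∉ Finset.powersetCard d (Finset.univ : Finset (Fin M)) → ∀ f,
      μ.real (X ⁻¹' {(c, f)}) = 0 := by
    rw [Fintype.sum_prod_type] at htot
    rw [← Finset.sum_add_sum_compl (Finset.powersetCard d (Finset.univ : Finset (Fin M))), hcard] at htot
    have h0 := add_eq_left.mp htot
    rw [Finset.sum_eq_zero_iff_of_nonneg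
      (fun c _ => Finset.sum_nonneg fun f _ => measureReal_nonneg)] at h0
    intro c hc f
    have h1 := h0 c (Finset.mem_compl.mpr hc)
    rw [Finset.sum_eq_zero_iff_of_nonneg (fun f _ => measureReal_nonneg)] at h1
    exact h1 f (Finset.mem_univ _)
  have hIntF : ∀ F : Finset (Fin M) × (Fin N → (Fin M → Bool) × Bool) → ℝ,
      ∫ ω, F (X ω) ∂μ = (Nat.choose M d : ℝ)⁻¹ *
        ∑ c ∈ Finset.powersetCard d (Finset.univ : Finset (Fin M)),
        ∑ f : Fin N → (Fin M → Bool) × Bool, (∏ i, auxW (f i)) * F (c, f) := by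
    intro F
    rw [aux_integral_fin μ X hX F, Fintype.sum_prod_type, Finset.mul_sum]
    symm
    apply Finset.sum_subset_zero_on_sdiff (Finset.subset_univ _)
    · intro c hc
      refine Finset.sum_eq_zero fun f _ => ?_
      rw [hzero c (Finset.mem_sdiff.mp hc).2 f, zero_mul]
    · intro c hc
      rw [Finset.mul_sum]
      refine Finset.sum_congr rfl fun f _ => ?_
      rw [hatom (c, f) (Finset.mem_powersetCard.mp hc).2, mul_assoc]
  have hmH : MeasurableSet H := by
    have : H = ⋃ a : Finset (Fin M) × (Fin N → (Fin M → Bool) × Bool),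
        ⋃ (_ : ∀ i, auxCnt (a.2 i).1 = h i), X ⁻¹' {a} := by
      rw [hH]
      ext ω
      simp only [Set.mem_setOf_eq, Set.mem_iUnion, Set.mem_preimage, Set.mem_singleton_iff]
      constructor
      · intro hω
        exact ⟨X ω, hω, rfl⟩
      · rintro ⟨a, ha, rfl⟩
        exact ha
    rw [this]
    exact MeasurableSet.iUnion fun a => MeasurableSet.iUnion fun _ => hX a
  have hmem : ∀ ω, ω ∈ H ↔ ∀ i, auxCnt ((X ω).2 i).1 = h i := by
    intro ω
    rw [hH]
    rfl
  have hW' : ∀ f : Fin N → (Fin M → Bool) × Bool, ∏ i, auxW' (h i) (f i) =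
      if ∀ i, auxCnt (f i).1 = h i then ∏ i, auxW (f i) else 0 := by
    intro f
    split_ifs with hf
    · exact Finset.prod_congr rfl fun i _ => by simp [auxW', hf i]
    · push Not at hf
      obtain ⟨i, hi⟩ := hf
      exact Finset.prod_eq_zero (Finset.mem_univ i) (by simp [auxW', hi])
  have hQ0 : ∀ i, ∑ x : (Fin M → Bool) × Bool, auxW' (h i) x ≠ 0 := fun i =>
    (auxQ_pos (h i) (hh i)).ne'
  have hden : (μ H).toReal = ∏ i, ∑ x : (Fin M → Bool) × Bool, auxW' (h i) x := by
    have h1 : (μ H).toReal = ∫ ω, (fun a : Finset (Fin M) × (Fin N → (Fin M → Bool) × Bool) =>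
        if ∀ i, auxCnt (a.2 i).1 = h i then (1:ℝ) else 0) (X ω) ∂μ := by
      have : ∀ ω, (fun a : Finset (Fin M) × (Fin N → (Fin M → Bool) × Bool) =>
        if ∀ i, auxCnt (a.2 i).1 = h i then (1:ℝ) else 0) (X ω) = H.indicator (fun _ => (1:ℝ)) ω := by
        intro ω
        simp only [Set.indicator, hmem]
      simp_rw [this]
      rw [integral_indicator_const _ hmH]
      simp [Measure.real]
    rw [h1]
    refine (hIntF (fun a : Finset (Fin M) × (Fin N → (Fin M → Bool) × Bool) =>
        if ∀ i, auxCnt (a.2 i).1 = h i then (1:ℝ) else 0)).trans ?_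
    have h2 : ∀ f : Fin N → (Fin M → Bool) × Bool, ((∏ i, auxW (f i)) *
        if ∀ i, auxCnt (f i).1 = h i then (1:ℝ) else 0) = ∏ i, auxW' (h i) (f i) := by
      intro f
      rw [hW']
      split_ifs <;> simp
    simp only [h2]
    rw [← Fintype.prod_sum (fun (i : Fin N) (x : (Fin M → Bool) × Bool) => auxW' (h i) x)]
    simp [hK.ne']
  have hnum : ∫ ω in H, (Y ω : ℝ) ∂μ = (Nat.choose M d : ℝ)⁻¹ *
      ∑ c ∈ Finset.powersetCard d (Finset.univ : Finset (Fin M)),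
        (∏ i, ∑ x : (Fin M → Bool) × Bool, auxW' (h i) x) *
        ∑ i, (∑ x : (Fin M → Bool) × Bool, auxW' (h i) x * auxG c x) /
          ∑ x : (Fin M → Bool) × Bool, auxW' (h i) x := by
    rw [← integral_indicator hmH]
    have : ∀ ω, H.indicator (fun ω => (Y ω : ℝ)) ω =
        (fun a : Finset (Fin M) × (Fin N → (Fin M → Bool) × Bool) =>
        if ∀ i, auxCnt (a.2 i).1 = h i then ∑ i, auxG a.1 (a.2 i) else 0) (X ω) := by
      intro ω
      simp only [Set.indicator, hmem]
      refine if_congr Iff.rfl ?_ rfl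
      rw [hY]
      simp only [auxG, X, Finset.sum_boole]
    simp_rw [this]
    refine (hIntF (fun a : Finset (Fin M) × (Fin N → (Fin M → Bool) × Bool) =>
        if ∀ i, auxCnt (a.2 i).1 = h i then ∑ i, auxG a.1 (a.2 i) else 0)).trans ?_
    congr 1
    refine Finset.sum_congr rfl fun c _ => ?_
    rw [← aux_prod_sum (fun i x => auxW' (h i) x) (fun _ x => auxG c x) hQ0]
    refine Finset.sum_congr rfl fun f _ => ?_
    rw [hW']
    split_ifs <;> simp
  rw [hnum, hden, ← Finset.mul_sum, Finset.sum_comm]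
  rw [Finset.sum_congr rfl fun i _ => auxR d (h i) hd1 (hh i)]
  have hP : (∏ i, ∑ x : (Fin M → Bool) × Bool, auxW' (h i) x) ≠ 0 :=
    Finset.prod_ne_zero_iff.mpr fun i _ => hQ0 i
  rw [mul_left_comm, mul_div_cancel_left₀ _ hP, Finset.mul_sum]
  refine Finset.sum_congr rfl fun i _ => ?_
  ring
end

section
/- Let ε be a random variable uniformly distributed on [0,1]. Conditionally on ε, let r_1, …, r_M (receptions of M data packets) and s (reception of the coded packet) be conditionally independent Bernoulli(1−ε) random variables. Let C be a subset of {1, …, M} of size d (1 ≤ d ≤ M) chosen uniformly at random, independently of everything else. Then for every h with 0 ≤ h ≤ M, Pr( s = 1 and exactly one j ∈ C has r_j = 0 | Σ_{j=1}^M r_j = h ) = ( C(h, d−1)·(M−h)/C(M, d) ) · ( (h+1)/(M+2) ), where C(n,k) denotes the binomial coefficient. -/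
open MeasureTheory
open scoped ENNReal

lemma beta_rec (a b : ℕ) :
    ((b : ℝ) + 1) * (∫ x in (0:ℝ)..1, (1 - x) ^ (a + 1) * x ^ b)
      = ((a : ℝ) + 1) * ∫ x in (0:ℝ)..1, (1 - x) ^ a * x ^ (b + 1) := by
  have hd : ∀ x ∈ Set.uIcc (0:ℝ) 1, HasDerivAt (fun x : ℝ => (1 - x) ^ (a + 1) * x ^ (b + 1))
      (((b : ℝ) + 1) * ((1 - x) ^ (a + 1) * x ^ b) - ((a : ℝ) + 1) * ((1 - x) ^ a * x ^ (b + 1))) x := by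
    intro x _
    have h1 : HasDerivAt (fun x : ℝ => 1 - x) (-1) x := by
      simpa using (hasDerivAt_id x).const_sub 1
    have h2 := (h1.fun_pow (a + 1)).mul ((hasDerivAt_id' x).fun_pow (b + 1))
    refine HasDerivAt.congr_deriv (f := fun x : ℝ => (1 - x) ^ (a + 1) * x ^ (b + 1)) h2 ?_
    simp only [Nat.add_sub_cancel]
    push_cast
    ring
  have := intervalIntegral.integral_eq_sub_of_hasDerivAt hd
    (Continuous.intervalIntegrable (by fun_prop) _ _)
  rw [intervalIntegral.integral_sub (Continuous.intervalIntegrable (by fun_prop) _ _)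
    (Continuous.intervalIntegrable (by fun_prop) _ _), intervalIntegral.integral_const_mul,
    intervalIntegral.integral_const_mul] at this
  simp at this
  linarith

lemma beta_val (a : ℕ) : ∀ b : ℕ, (∫ x in (0:ℝ)..1, (1 - x) ^ a * x ^ b)
    = (a.factorial * b.factorial : ℝ) / ((a + b + 1).factorial : ℝ) := by
  induction a with
  | zero =>
    intro b
    simp [integral_pow, Nat.factorial_succ]
    field_simp
  | succ a ih =>
    intro b
    have h1 := beta_rec a b
    rw [ih (b + 1)] at h1
    have hb : ((b : ℝ) + 1) ≠ 0 := by positivity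
    have e : a + 1 + b + 1 = a + (b + 1) + 1 := by ring
    rw [e]
    apply mul_left_cancel₀ hb
    rw [h1, Nat.factorial_succ a, Nat.factorial_succ b]
    push_cast
    ring

lemma count_c (M d : ℕ) (hd1 : 1 ≤ d) (R : Finset (Fin M)) :
    (Finset.univ.filter fun c : Finset (Fin M) => c.card = d ∧ (c \ R).card = 1).card
      = Nat.choose R.card (d - 1) * (M - R.card) := by
  have : (Finset.powersetCard (d - 1) R ×ˢ Finset.powersetCard 1 Rᶜ).card
      = Nat.choose R.card (d - 1) * (M - R.card) := by
    rw [Finset.card_product, Finset.card_powersetCard, Finset.card_powersetCard,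
      Finset.card_compl]
    simp
  rw [← this]
  refine Finset.card_nbij' (fun c => (c ∩ R, c \ R)) (fun p => p.1 ∪ p.2) ?_ ?_ ?_ ?_
  · intro c hc
    simp only [Finset.coe_filter, Finset.mem_univ, true_and, Set.mem_ofPred_eq] at hc
    simp only [Finset.coe_product, Set.mem_prod, Finset.mem_coe, Finset.mem_powersetCard]
    have := Finset.card_inter_add_card_sdiff c R
    refine ⟨⟨Finset.inter_subset_right, by omega⟩, ?_, hc.2⟩
    intro x hx
    simp at hx ⊢
    exact hx.2
  · rintro ⟨u, v⟩ hp
    simp only [Finset.coe_product, Set.mem_prod, Finset.mem_coe, Finset.mem_powersetCard] at hp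
    simp only [Finset.coe_filter, Finset.mem_univ, true_and, Set.mem_ofPred_eq]
    obtain ⟨⟨hu, hu2⟩, hv, hv2⟩ := hp
    have hdis : Disjoint u v :=
      Finset.disjoint_of_subset_left hu (Finset.disjoint_of_subset_right hv disjoint_compl_right)
    have e : (u ∪ v) \ R = v := by
      ext x
      have h1 := @hu x
      have h2 := @hv x
      simp at h1 h2 ⊢
      tauto
    rw [e, Finset.card_union_of_disjoint hdis]
    omega
  · intro c _
    ext x
    simp
    tauto
  · rintro ⟨u, v⟩ hp
    simp only [Finset.coe_product, Set.mem_prod, Finset.mem_coe, Finset.mem_powersetCard] at hp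
    obtain ⟨⟨hu, hu2⟩, hv, hv2⟩ := hp
    ext x <;> have h1 := @hu x <;> have h2 := @hv x <;> simp at h1 h2 ⊢ <;> tauto

/-- the erasure rate `ε` of a user is uniform on `[0,1]`; given `ε`, the
receptions `r_1, …, r_M` of the data packets and the reception `s` of the coded packet
are conditionally independent `Bernoulli(1−ε)`; the coding set `C` is a uniformly random
`d`-subset of the `M` packets, independent of everything else (this joint law is
specified by `hlaw`). Then for `0 ≤ h ≤ M`,
`Pr(s = 1 ∧ exactly one j ∈ C has r_j = 0 | Σ_j r_j = h)
  = (C(h,d−1)·(M−h)/C(M,d)) · ((h+1)/(M+2))`. -/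
theorem stmt_4 {Ω : Type*} [MeasurableSpace Ω] (μ : Measure Ω) [IsProbabilityMeasure μ]
    (M d : ℕ) (hd1 : 1 ≤ d) (hdM : d ≤ M)
    (eps : Ω → ℝ) (r : Fin M → Ω → Bool) (s : Ω → Bool) (C : Ω → Finset (Fin M))
    (hmeas_eps : Measurable eps) (hmeas_r : ∀ j, Measurable (r j))
    (hmeas_s : Measurable s) (hmeas_C : ∀ c, MeasurableSet {ω | C ω = c})
    (hlaw : ∀ (A : Set ℝ), MeasurableSet A → ∀ (b : Fin M → Bool) (t : Bool)
        (c : Finset (Fin M)), c.card = d →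
      μ {ω | eps ω ∈ A ∧ (∀ j, r j ω = b j) ∧ s ω = t ∧ C ω = c}
        = ((Nat.choose M d : ℝ≥0∞))⁻¹ *
          ∫⁻ x in A, ENNReal.ofReal
            ((∏ j, if b j then 1 - x else x) * (if t then 1 - x else x))
            ∂(volume.restrict (Set.Icc (0 : ℝ) 1)))
    (h : ℕ) (hh : h ≤ M) :
    (μ {ω | s ω = true ∧ ((C ω).filter fun j => r j ω = false).card = 1 ∧
            (∑ j, if r j ω then 1 else 0) = h}).toReal
      / (μ {ω | (∑ j, if r j ω then 1 else 0) = h}).toReal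
      = ((Nat.choose h (d - 1) : ℝ) * ((M : ℝ) - (h : ℝ)) / (Nat.choose M d : ℝ))
          * (((h : ℝ) + 1) / ((M : ℝ) + 2)) := by
  classical
  set f : Ω → Finset (Fin M) × Bool × Finset (Fin M) :=
    fun ω => (Finset.univ.filter fun j => r j ω = true, s ω, C ω) with hf
  set W : ℕ → Bool → ℝ := fun k t =>
    ∫ x in (0:ℝ)..1, (1 - x) ^ k * x ^ (M - k) * (if t then 1 - x else x) with hW
  have hpre : ∀ R t c, f ⁻¹' {(R, t, c)} =
      {ω | eps ω ∈ Set.univ ∧ (∀ j, r j ω = decide (j ∈ R)) ∧ s ω = t ∧ C ω = c} := by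
    intro R t c
    ext ω
    simp only [hf, Set.mem_preimage, Set.mem_singleton_iff, Prod.mk.injEq, Set.mem_ofPred_eq,
      Set.mem_univ, true_and]
    refine and_congr_left fun _ => ?_
    rw [Finset.ext_iff]
    refine forall_congr' fun j => ?_
    simp only [Finset.mem_filter, Finset.mem_univ, true_and]
    by_cases hj : j ∈ R <;> simp [hj]
  have hms : ∀ z, MeasurableSet (f ⁻¹' {z}) := by
    rintro ⟨R, t, c⟩
    rw [hpre]
    have e : {ω | eps ω ∈ Set.univ ∧ (∀ j, r j ω = decide (j ∈ R)) ∧ s ω = t ∧ C ω = c}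
      = (⋂ j, r j ⁻¹' {decide (j ∈ R)}) ∩ (s ⁻¹' {t} ∩ {ω | C ω = c}) := by
      ext ω
      simp
    rw [e]
    exact (MeasurableSet.iInter fun j => hmeas_r j (measurableSet_singleton _)).inter
      ((hmeas_s (measurableSet_singleton _)).inter (hmeas_C c))
  have hprod : ∀ (R : Finset (Fin M)) (x : ℝ),
      (∏ j, if decide (j ∈ R) = true then 1 - x else x) = (1 - x) ^ R.card * x ^ (M - R.card) := by
    intro R x
    simp only [decide_eq_true_eq]
    rw [Finset.prod_ite, Finset.prod_const, Finset.prod_const]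
    congr 2
    · congr 1
      ext j
      simp
    · have : (Finset.univ.filter fun j => j ∉ R) = Rᶜ := by
        ext j
        simp
      rw [this, Finset.card_compl, Fintype.card_fin]
  have hpt : ∀ R t c, c.card = d →
      μ.real (f ⁻¹' {(R, t, c)}) = (Nat.choose M d : ℝ)⁻¹ * W R.card t := by
    intro R t c hc
    rw [hpre, measureReal_def, hlaw _ MeasurableSet.univ _ _ _ hc, ENNReal.toReal_mul]
    congr 1
    · simp
    · simp only [hprod, hW, Measure.restrict_univ]
      rw [← integral_eq_lintegral_of_nonneg_ae, intervalIntegral.integral_of_le zero_le_one,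
        integral_Icc_eq_integral_Ioc]
      · refine (ae_restrict_mem measurableSet_Icc).mono fun x hx => ?_
        have h0 : 0 ≤ x := hx.1
        have h1 : 0 ≤ 1 - x := by linarith [hx.2]
        have h2 : 0 ≤ (if t = true then 1 - x else x) := by split_ifs <;> assumption
        simp only [Pi.zero_apply]
        positivity
      · cases t <;> exact Continuous.aestronglyMeasurable (by simp; fun_prop)
  have hWadd : ∀ k, W k true + W k false = ∫ x in (0:ℝ)..1, (1 - x) ^ k * x ^ (M - k) := by
    intro k
    simp only [hW]
    rw [← intervalIntegral.integral_add]
    · congr 1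
      ext x
      simp
      ring
    · exact Continuous.intervalIntegrable (by simp; fun_prop) _ _
    · exact Continuous.intervalIntegrable (by simp; fun_prop) _ _
  have hWtrue : ∀ k, W k true = ∫ x in (0:ℝ)..1, (1 - x) ^ (k + 1) * x ^ (M - k) := by
    intro k
    simp only [hW]
    congr 1
    ext x
    simp
    ring
  have hch : (Nat.choose M d : ℝ) ≠ 0 := by
    exact_mod_cast (Nat.choose_pos hdM).ne'
  have hcardC : (Finset.univ.filter fun c : Finset (Fin M) => c.card = d).card
      = Nat.choose M d := by
    have : (Finset.univ.filter fun c : Finset (Fin M) => c.card = d)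
      = Finset.powersetCard d Finset.univ := by
      ext c
      simp [Finset.mem_powersetCard]
    rw [this]
    simp
  have hcardR : (Finset.univ.filter fun c : Finset (Fin M) => c.card = h).card
      = Nat.choose M h := by
    have : (Finset.univ.filter fun c : Finset (Fin M) => c.card = h)
      = Finset.powersetCard h Finset.univ := by
      ext c
      simp [Finset.mem_powersetCard]
    rw [this]
    simp
  -- the explicit point mass function
  set P : Finset (Fin M) × Bool × Finset (Fin M) → ℝ := fun z =>
    if z.2.2.card = d then (Nat.choose M d : ℝ)⁻¹ * W z.1.card z.2.1 else 0 with hP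
  have hmarg : ∀ R, ∑ t, ∑ c, P (R, t, c)
      = ∫ x in (0:ℝ)..1, (1 - x) ^ R.card * x ^ (M - R.card) := by
    intro R
    rw [← hWadd]
    simp only [hP, ← Finset.sum_filter, Finset.sum_const, hcardC, nsmul_eq_mul,
      Fintype.sum_bool]
    field_simp
  have hPsum : ∑ z, P z = 1 := by
    rw [Fintype.sum_prod_type]
    simp only [Fintype.sum_prod_type (γ := ℝ), hmarg]
    rw [← intervalIntegral.integral_finsetSum]
    · simp [Fin.sum_pow_mul_eq_add_pow]
    · intro i _
      exact Continuous.intervalIntegrable (by fun_prop) _ _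
  have htot : ∑ z, μ.real (f ⁻¹' {z}) = 1 := by
    rw [sum_measureReal_preimage_singleton _ (fun z _ => hms z)]
    simp
  have hle : ∀ z ∈ Finset.univ, P z ≤ μ.real (f ⁻¹' {z}) := by
    rintro ⟨R, t, c⟩ _
    simp only [hP]
    split_ifs with hc
    · exact (hpt R t c hc).ge
    · exact measureReal_nonneg
  have hPeq : ∀ z, μ.real (f ⁻¹' {z}) = P z := fun z =>
    (((Finset.sum_eq_sum_iff_of_le hle).1 (by rw [hPsum, htot])) z (Finset.mem_univ z)).symm
  have hprob : ∀ (p : Finset (Fin M) × Bool × Finset (Fin M) → Prop) [DecidablePred p],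
      (μ {ω | p (f ω)}).toReal = ∑ R, ∑ t, ∑ c, if p (R, t, c) then P (R, t, c) else 0 := by
    intro p _
    have e : {ω | p (f ω)} = f ⁻¹' (Finset.univ.filter p : Finset _) := by
      ext ω
      simp
    rw [e, ← measureReal_def, ← sum_measureReal_preimage_singleton _ (fun z _ => hms z),
      Finset.sum_filter, Fintype.sum_prod_type]
    simp only [Fintype.sum_prod_type (γ := ℝ), hPeq]
  have hden : (μ {ω | (∑ j, if r j ω then 1 else 0) = h}).toReal
      = Nat.choose M h * ∫ x in (0:ℝ)..1, (1 - x) ^ h * x ^ (M - h) := by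
    have e : {ω | (∑ j, if r j ω then 1 else 0) = h}
        = {ω | (fun z : Finset (Fin M) × Bool × Finset (Fin M) => z.1.card = h) (f ω)} := by
      ext ω
      simp [hf]
    rw [e, hprob (fun z : Finset (Fin M) × Bool × Finset (Fin M) => z.1.card = h)]
    have : ∀ R : Finset (Fin M), (∑ t, ∑ c, if R.card = h then P (R, t, c) else 0)
        = if R.card = h then ∫ x in (0:ℝ)..1, (1 - x) ^ h * x ^ (M - h) else 0 := by
      intro R
      split_ifs with hR
      · rw [hmarg, hR]
      · simp
    simp only [this]
    rw [← Finset.sum_filter, Finset.sum_const, hcardR, nsmul_eq_mul]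
  have hnum : (μ {ω | s ω = true ∧ ((C ω).filter fun j => r j ω = false).card = 1 ∧
            (∑ j, if r j ω then 1 else 0) = h}).toReal
      = Nat.choose M h * ((Nat.choose h (d - 1) * (M - h : ℕ) : ℕ) * ((Nat.choose M d : ℝ)⁻¹ *
        ∫ x in (0:ℝ)..1, (1 - x) ^ (h + 1) * x ^ (M - h))) := by
    have e : {ω | s ω = true ∧ ((C ω).filter fun j => r j ω = false).card = 1 ∧
            (∑ j, if r j ω then 1 else 0) = h}
        = {ω | (fun z : Finset (Fin M) × Bool × Finset (Fin M) =>
            z.2.1 = true ∧ (z.2.2 \ z.1).card = 1 ∧ z.1.card = h) (f ω)} := by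
      ext ω
      have e1 : (C ω) \ (Finset.univ.filter fun j => r j ω = true)
          = (C ω).filter fun j => r j ω = false := by
        ext j
        simp
      simp only [hf, Set.mem_ofPred_eq, e1]
      simp
    rw [e, hprob (fun z : Finset (Fin M) × Bool × Finset (Fin M) =>
            z.2.1 = true ∧ (z.2.2 \ z.1).card = 1 ∧ z.1.card = h)]
    have : ∀ R : Finset (Fin M), (∑ t, ∑ c, if t = true ∧ (c \ R).card = 1 ∧ R.card = h
          then P (R, t, c) else 0)
        = if R.card = h then ((Nat.choose h (d - 1) * (M - h : ℕ) : ℕ) * ((Nat.choose M d : ℝ)⁻¹ *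
        ∫ x in (0:ℝ)..1, (1 - x) ^ (h + 1) * x ^ (M - h))) else 0 := by
      intro R
      split_ifs with hR
      · have := count_c M d hd1 R
        rw [hR] at this
        rw [← this, ← hWtrue, ← nsmul_eq_mul, ← Finset.sum_const, Finset.sum_filter]
        simp only [Fintype.sum_bool, hP, hR]
        simp only [true_and, and_true, Bool.false_eq_true, false_and, if_false,
          Finset.sum_const_zero, add_zero]
        refine Finset.sum_congr rfl fun c _ => ?_
        by_cases h1 : c.card = d <;> by_cases h2 : (c \ R).card = 1 <;> simp [h1, h2]
      · simp [hR]
    simp only [this]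
    rw [← Finset.sum_filter, Finset.sum_const, hcardR, nsmul_eq_mul]
  rw [hnum, hden, beta_val, beta_val]
  have hMh : (Nat.choose M h : ℝ) ≠ 0 := by
    exact_mod_cast (Nat.choose_pos hh).ne'
  have e1 : h + 1 + (M - h) + 1 = (M + 1) + 1 := by omega
  have e2 : h + (M - h) + 1 = M + 1 := by omega
  rw [e1, e2, Nat.factorial_succ (M + 1), Nat.factorial_succ h]
  have f1 : ((M + 1).factorial : ℝ) ≠ 0 := by positivity
  have f2 : (h.factorial : ℝ) ≠ 0 := by positivity
  have f3 : ((M - h).factorial : ℝ) ≠ 0 := by positivity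
  have f4 : (M : ℝ) + 2 ≠ 0 := by positivity
  have f5 : (M : ℝ) + 1 + 1 ≠ 0 := by positivity
  push_cast [Nat.cast_sub hh]
  rw [show (M : ℝ) + 1 + 1 = M + 2 by ring]
  field_simp
end
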